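/- arXiv:2308.07668 — 2 statements merged into one kernel-verified Lean document; each statement's English description precedes it below -/
import Mathlib

section
/- Let 1 < p < ∞ and let Γ be a set of cardinality ℵ₁. Then the unit sphere of ℓ_p(Γ) is not the union of countably many sets each of diameter at most 2^{1/p}. -/
open scoped ENNReal

theorem aux_disj {Γ : Type} (p : ℝ≥0∞) [Fact (1 ≤ p)] (hptop : p ≠ ∞)
    (x y : lp (fun _ : Γ => ℝ) p) (h : ∀ i, x i = 0 ∨ y i = 0) :
    ‖x + y‖ ^ p.toReal = ‖x‖ ^ p.toReal + ‖y‖ ^ p.toReal := by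
  have h1 : (1 : ℝ≥0∞) ≤ p := Fact.out
  have hp : 0 < p.toReal := ENNReal.toReal_pos (by positivity) hptop
  have hx := lp.hasSum_norm hp x
  have hy := lp.hasSum_norm hp y
  have hxy := lp.hasSum_norm hp (x + y)
  refine hxy.unique ?_
  convert hx.add hy using 2 with i
  rcases h i with h | h <;> simp [h, Real.zero_rpow hp.ne']

theorem aux_supp {Γ : Type} (p : ℝ≥0∞) [Fact (1 ≤ p)] (hptop : p ≠ ∞)
    (x : lp (fun _ : Γ => ℝ) p) : {i | x i ≠ 0}.Countable := by
  have h1 : (1 : ℝ≥0∞) ≤ p := Fact.out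
  have hp : 0 < p.toReal := ENNReal.toReal_pos (by positivity) hptop
  refine (lp.hasSum_norm hp x).summable.countable_support.mono ?_
  intro i hi
  simp only [Function.mem_support]
  have : 0 < ‖x i‖ := norm_pos_iff.2 hi
  positivity

theorem aux_baire {Γ : Type} [Uncountable Γ] (p : ℝ≥0∞) [Fact (1 ≤ p)] (hptop : p ≠ ∞)
    (f : ℕ → Set (lp (fun _ : Γ => ℝ) p))
    (hf : (⋃ n, f n) = {x : lp (fun _ : Γ => ℝ) p | ‖x‖ = 1})
    (A : Set Γ) (hA : A.Countable) :
    ∃ n k : ℕ, ∃ u : lp (fun _ : Γ => ℝ) p, ‖u‖ = 1 ∧ (∀ a ∈ A, u a = 0) ∧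
      ∀ x : lp (fun _ : Γ => ℝ) p, ‖x‖ = 1 → (∀ a ∈ A, x a = 0) →
        dist x u < 1 / ((k : ℝ) + 1) → x ∈ closure (f n) := by
  classical
  have h1 : (1 : ℝ≥0∞) ≤ p := Fact.out
  have hp : 0 < p.toReal := ENNReal.toReal_pos (by positivity) hptop
  set S : Set (lp (fun _ : Γ => ℝ) p) := {x | ‖x‖ = 1 ∧ ∀ a ∈ A, x a = 0} with hS
  have hev : ∀ a : Γ, Continuous (fun x : lp (fun _ : Γ => ℝ) p => x a) := by
    intro a
    refine (LipschitzWith.of_dist_le_mul (K := 1) fun x y => ?_).continuous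
    rw [dist_eq_norm, dist_eq_norm, NNReal.coe_one, one_mul]
    exact lp.norm_apply_le_norm (by positivity) (x - y) a
  have hcl : IsClosed S := by
    have : S = {x | ‖x‖ = 1} ∩ ⋂ a ∈ A, {x | x a = 0} := by
      ext x; simp [hS]
    rw [this]
    refine (isClosed_eq continuous_norm continuous_const).inter ?_
    exact isClosed_biInter fun a _ => isClosed_eq (hev a) continuous_const
  have : CompleteSpace S := hcl.completeSpace_coe
  obtain ⟨g, hg⟩ : ∃ g, g ∉ A := by
    by_contra! h
    exact Set.not_countable_univ (hA.mono fun x _ => h x)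
  have : Nonempty S := by
    refine ⟨⟨lp.single p g (1 : ℝ), ?_, ?_⟩⟩
    · rw [lp.norm_single (by positivity)]; simp
    · intro a ha
      have : a ≠ g := fun h => hg (h ▸ ha)
      simp [lp.single_apply, this]
  obtain ⟨n, u, hu⟩ := nonempty_interior_of_iUnion_of_closed
    (f := fun n => ((↑) : S → lp (fun _ : Γ => ℝ) p) ⁻¹' closure (f n))
    (fun n => isClosed_closure.preimage continuous_subtype_val)
    (by
      rw [Set.eq_univ_iff_forall]
      intro x
      have : (x : lp (fun _ : Γ => ℝ) p) ∈ ⋃ n, f n := by rw [hf]; exact x.2.1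
      obtain ⟨n, hn⟩ := Set.mem_iUnion.1 this
      exact Set.mem_iUnion.2 ⟨n, subset_closure hn⟩)
  obtain ⟨e, he, hb⟩ := Metric.mem_nhds_iff.1 (mem_interior_iff_mem_nhds.1 hu)
  obtain ⟨k, hk⟩ := exists_nat_one_div_lt he
  refine ⟨n, k, u, u.2.1, u.2.2, fun x hx hxA hd => ?_⟩
  exact hb (show (⟨x, hx, hxA⟩ : S) ∈ Metric.ball u e from hd.trans hk)

theorem aux_near {E : Type*} [NormedAddCommGroup E] [NormedSpace ℝ E] (u v : E) (N : ℝ)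
    (hu : ‖u‖ = 1) (hN : ‖u + v‖ = N) (hN0 : 0 < N) :
    ‖N⁻¹ • (u + v)‖ = 1 ∧ dist (N⁻¹ • (u + v)) u ≤ 2 * ‖v‖ := by
  constructor
  · rw [norm_smul, hN, norm_inv, Real.norm_of_nonneg hN0.le, inv_mul_cancel₀ hN0.ne']
  · have e : N⁻¹ • (u + v) - u = (N⁻¹ - 1) • (u + v) + v := by
      rw [sub_smul, one_smul]; abel
    have h1 : ‖(N⁻¹ - 1) • (u + v)‖ = |1 - N| := by
      rw [norm_smul, hN, Real.norm_eq_abs]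
      nth_rewrite 2 [← abs_of_pos hN0]
      rw [← abs_mul, sub_mul, inv_mul_cancel₀ hN0.ne', one_mul]
    have h2 : |1 - N| ≤ ‖v‖ := by
      have := abs_norm_sub_norm_le u (u + v)
      rw [hu, hN] at this
      simpa using this
    rw [dist_eq_norm, e]
    have := norm_add_le ((N⁻¹ - 1) • (u + v)) v
    linarith

/- STATEMENT 14: Let `1 < p < ∞` and let `Γ` be a set of cardinality `ℵ₁`.  Then the
unit sphere of `ℓ_p(Γ)` is not the union of countably many sets each of diameter at
most `2^(1/p)`. -/
theorem stmt14 (p : ℝ≥0∞) [Fact (1 ≤ p)] (hp1 : 1 < p) (hptop : p ≠ ∞)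
    (Γ : Type) (hΓ : Cardinal.mk Γ = Cardinal.aleph 1) :
    ¬∃ f : ℕ → Set (lp (fun _ : Γ => ℝ) p),
        (⋃ n, f n) = {x : lp (fun _ : Γ => ℝ) p | ‖x‖ = 1} ∧
        ∀ n, Metric.diam (f n) ≤ (2 : ℝ) ^ (1 / p.toReal) := by
  classical
  rintro ⟨f, hf, hd⟩
  have hp : 0 < p.toReal := ENNReal.toReal_pos (by positivity) hptop
  have hp1' : 1 < p.toReal := by
    rw [← ENNReal.toReal_one]
    exact (ENNReal.toReal_lt_toReal ENNReal.one_ne_top hptop).2 hp1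
  have : Uncountable Γ := by
    rw [← Cardinal.aleph0_lt_mk_iff, hΓ]
    exact Cardinal.aleph0_lt_aleph_one
  -- some pair (n, k) works for cofinally many countable sets
  obtain ⟨n, k, hnk⟩ : ∃ n k : ℕ, ∀ B : Set Γ, B.Countable → ∃ A : Set Γ, A.Countable ∧ B ⊆ A ∧
      ∃ u : lp (fun _ : Γ => ℝ) p, ‖u‖ = 1 ∧ (∀ a ∈ A, u a = 0) ∧
      ∀ x : lp (fun _ : Γ => ℝ) p, ‖x‖ = 1 → (∀ a ∈ A, x a = 0) →
        dist x u < 1 / ((k : ℝ) + 1) → x ∈ closure (f n) := by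
    by_contra! h
    choose B hB hB' using h
    have hc : (⋃ n, ⋃ k, B n k).Countable :=
      Set.countable_iUnion fun n => Set.countable_iUnion fun k => hB n k
    obtain ⟨n, k, u, hu1, hu2, hu3⟩ := aux_baire p hptop f hf _ hc
    obtain ⟨x, h1, h2, h3, h4⟩ := hB' n k _ hc
      ((Set.subset_iUnion (B n) k).trans (Set.subset_iUnion (fun n => ⋃ k, B n k) n)) u hu1 hu2
    exact h4 (hu3 x h1 h2 h3)
  obtain ⟨A, hA, -, u, hu1, huA, hu⟩ := hnk ∅ Set.countable_empty
  obtain ⟨B, hB, hAB, v, hv1, hvB, hv⟩ := hnk (A ∪ {i | u i ≠ 0})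
    (hA.union (aux_supp p hptop u))
  obtain ⟨g, hg⟩ : ∃ g, g ∉ B ∪ {i | v i ≠ 0} := by
    by_contra! h
    exact Set.not_countable_univ ((hB.union (aux_supp p hptop v)).mono fun x _ => h x)
  have hgB : g ∉ B := fun h => hg (Or.inl h)
  have hgv : v g = 0 := by by_contra h; exact hg (Or.inr h)
  have hgA : g ∉ A := fun h => hgB (hAB (Or.inl h))
  have hgu : u g = 0 := by by_contra h; exact hgB (hAB (Or.inr h))
  have huv : ∀ i, u i = 0 ∨ v i = 0 := by
    intro i
    by_cases h : u i = 0
    · exact Or.inl h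
    · exact Or.inr (hvB i (hAB (Or.inr h)))
  have hk : (0 : ℝ) < 1 / ((k : ℝ) + 1) := by positivity
  set t : ℝ := 1 / ((k : ℝ) + 1) / 4 with ht
  have ht0 : 0 < t := by positivity
  let e : ℝ → lp (fun _ : Γ => ℝ) p := fun s => lp.single p g s
  have he : ∀ s, ‖e s‖ = |s| := fun s => by
    simp only [e]; rw [lp.norm_single (by positivity)]; rfl
  have heg : ∀ s i, i ≠ g → e s i = 0 := fun s i hi => by simp [e, lp.single_apply, hi]
  have hdis : ∀ (w : lp (fun _ : Γ => ℝ) p) s, w g = 0 → ∀ i, w i = 0 ∨ e s i = 0 := by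
    intro w s hw i
    by_cases h : i = g
    · left; rw [h, hw]
    · right; exact heg s i h
  have hnorm : ∀ (w : lp (fun _ : Γ => ℝ) p) s, w g = 0 →
      ‖w + e s‖ ^ p.toReal = ‖w‖ ^ p.toReal + |s| ^ p.toReal := by
    intro w s hw
    rw [aux_disj p hptop w (e s) (hdis w s hw), he]
  set N : ℝ := (1 + t ^ p.toReal) ^ (1 / p.toReal) with hN
  have htp : 0 < t ^ p.toReal := by positivity
  have hN0 : 0 < N := by positivity
  have hNp : N ^ p.toReal = 1 + t ^ p.toReal := by
    rw [hN, ← Real.rpow_mul (by positivity), one_div_mul_cancel hp.ne', Real.rpow_one]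
  have hun : ‖u + e t‖ = N := by
    rw [← Real.rpow_left_inj (norm_nonneg _) hN0.le hp.ne', hNp, hnorm u t hgu, hu1,
      Real.one_rpow, abs_of_pos ht0]
  have hvn : ‖v + e (-t)‖ = N := by
    rw [← Real.rpow_left_inj (norm_nonneg _) hN0.le hp.ne', hNp, hnorm v (-t) hgv, hv1,
      Real.one_rpow, abs_neg, abs_of_pos ht0]
  obtain ⟨hx1, hx2⟩ := aux_near u (e t) N hu1 hun hN0
  obtain ⟨hy1, hy2⟩ := aux_near v (e (-t)) N hv1 hvn hN0
  rw [he, abs_of_pos ht0] at hx2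
  rw [he, abs_neg, abs_of_pos ht0] at hy2
  have hx := hu _ hx1 (fun a ha => by
    have : a ≠ g := fun h => hgA (h ▸ ha)
    change N⁻¹ * (u a + e t a) = 0
    rw [huA a ha, heg t a this]; simp) (by linarith)
  have hy := hv _ hy1 (fun a ha => by
    have : a ≠ g := fun h => hgB (h ▸ ha)
    change N⁻¹ * (v a + e (-t) a) = 0
    rw [hvB a ha, heg (-t) a this]; simp) (by linarith)
  have hbd : Bornology.IsBounded (f n) := by
    refine (Metric.isBounded_closedBall (x := (0 : lp (fun _ : Γ => ℝ) p)) (r := 1)).subset ?_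
    intro x hx
    have : x ∈ ⋃ n, f n := Set.mem_iUnion.2 ⟨n, hx⟩
    rw [hf] at this
    simpa using le_of_eq this
  have hdist := Metric.dist_le_diam_of_mem hbd.closure hx hy
  rw [Metric.diam_closure] at hdist
  replace hdist := hdist.trans (hd n)
  have hxy : N⁻¹ • (u + e t) - N⁻¹ • (v + e (-t)) = N⁻¹ • ((u + -v) + e (2 * t)) := by
    rw [← smul_sub]
    congr 1
    have h1 : e (-t) = - e t := by simp [e]
    have h2 : e (2 * t) = e t + e t := by simp only [e]; rw [two_mul, lp.single_add]
    rw [h1, h2]; abel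
  rw [dist_eq_norm, hxy, norm_smul, norm_inv, Real.norm_of_nonneg hN0.le] at hdist
  have h2 := Real.rpow_le_rpow (by positivity) hdist hp.le
  rw [← Real.rpow_mul (by positivity), one_div_mul_cancel hp.ne', Real.rpow_one,
    Real.mul_rpow (by positivity) (by positivity), Real.inv_rpow hN0.le, hNp,
    hnorm (u + -v) (2 * t) (by simp [hgu, hgv]),
    aux_disj p hptop u (-v) (fun i => by simpa using huv i), norm_neg, hu1, hv1, Real.one_rpow,
    abs_of_pos (by positivity), Real.mul_rpow (by positivity) ht0.le,
    inv_mul_le_iff₀ (by positivity)] at h2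
  have h3 : (2 : ℝ) < 2 ^ p.toReal := by
    simpa using Real.rpow_lt_rpow_of_exponent_lt (x := 2) (by norm_num) hp1'
  nlinarith
end

section
/- Suppose K is a locally compact, Hausdorff, nonmetrizable topological space. Then the unit sphere of the Banach space C₀(K) admits an uncountable (1+)-separated set. -/
open scoped ZeroAtInfty

open Set Filter Topology

namespace Stmt17

variable {K : Type*} [TopologicalSpace K]

lemma comb (u w : C₀(K, ℝ)) (a b : ℝ) :
    ∃ g : C₀(K, ℝ), ∀ z, g z = max (-1) (min 1 (a * u z - b * w z)) := by
  refine ⟨⟨⟨fun z => max (-1) (min 1 (a * u z - b * w z)), ?_⟩, ?_⟩, fun z => rfl⟩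
  · have hu : Continuous u := map_continuous u
    have hw : Continuous w := map_continuous w
    fun_prop
  · have hu : Tendsto u (cocompact K) (𝓝 0) := zero_at_infty u
    have hw : Tendsto w (cocompact K) (𝓝 0) := zero_at_infty w
    have h := (tendsto_const_nhds (x := (-1 : ℝ))).max
      ((tendsto_const_nhds (x := (1 : ℝ))).min ((hu.const_mul a).sub (hw.const_mul b)))
    have e : max (-1 : ℝ) (min 1 (a * 0 - b * 0)) = 0 := by norm_num
    rw [e] at h
    exact h

lemma abs_le_norm (f : C₀(K, ℝ)) (x : K) : |f x| ≤ ‖f‖ := by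
  have := f.toBCF.norm_coe_le_norm x
  simpa using this

lemma sep {f g : C₀(K, ℝ)} (x : K) (h : 1 < |f x - g x|) : 1 < ‖f - g‖ :=
  h.trans_le (by simpa using abs_le_norm (f - g) x)

lemma sep' {f g : C₀(K, ℝ)} (x : K) (h : 1 < f x - g x) : 1 < ‖f - g‖ :=
  sep x (h.trans_le (le_abs_self _))

lemma norm_one {g : C₀(K, ℝ)} (h : ∀ z, |g z| ≤ 1) (x : K) (hx : g x = 1) : ‖g‖ = 1 := by
  apply le_antisymm
  · rw [← ZeroAtInftyContinuousMap.norm_toBCF_eq_norm]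
    exact (BoundedContinuousFunction.norm_le zero_le_one).2 h
  · have := abs_le_norm g x
    rwa [hx, abs_one] at this

lemma clamp_abs (t : ℝ) : |max (-1) (min 1 t)| ≤ 1 := by
  rw [abs_le]
  exact ⟨le_max_left _ _, max_le (by norm_num) (min_le_left _ _)⟩

/-- Zorn-type principle replacing transfinite recursion of length `ω₁`. -/
lemma zorn_sep (G : Set C₀(K, ℝ)) (hG : ∀ f ∈ G, ‖f‖ = 1)
    (h : ∀ N : Set C₀(K, ℝ), N ⊆ G → N.Countable → ∃ g ∈ G, ∀ f ∈ N, 1 < ‖g - f‖) :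
    ∃ N : Set C₀(K, ℝ), N ⊆ {f : C₀(K, ℝ) | ‖f‖ = 1} ∧ ¬N.Countable ∧
      ∀ f ∈ N, ∀ g ∈ N, f ≠ g → 1 < ‖f - g‖ := by
  obtain ⟨N, hN⟩ := zorn_subset
    {N : Set C₀(K, ℝ) | N ⊆ G ∧ ∀ f ∈ N, ∀ g ∈ N, f ≠ g → 1 < ‖f - g‖} (by
      intro c hc hch
      refine ⟨⋃₀ c, ⟨sUnion_subset fun s hs => (hc hs).1, ?_⟩, fun s hs => subset_sUnion_of_mem hs⟩
      rintro f ⟨s, hs, hfs⟩ g ⟨t, ht, hgt⟩ hne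
      rcases hch.total hs ht with hst | hts
      · exact (hc ht).2 f (hst hfs) g hgt hne
      · exact (hc hs).2 f hfs g (hts hgt) hne)
  refine ⟨N, fun f hf => hG f (hN.prop.1 hf), fun hcount => ?_, hN.prop.2⟩
  obtain ⟨g, hgG, hg⟩ := h N hN.prop.1 hcount
  have hgN : g ∈ N := by
    have hins : insert g N ∈
        {N : Set C₀(K, ℝ) | N ⊆ G ∧ ∀ f ∈ N, ∀ g ∈ N, f ≠ g → 1 < ‖f - g‖} := by
      refine ⟨insert_subset hgG hN.prop.1, ?_⟩
      rintro a (rfl | ha) b (rfl | hb) hab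
      · exact absurd rfl hab
      · exact hg b hb
      · rw [norm_sub_rev]; exact hg a ha
      · exact hN.prop.2 a ha b hb hab
    exact hN.le_of_ge hins (subset_insert g N) (mem_insert g N)
  have := hg g hgN
  simp at this
  linarith

variable [LocallyCompactSpace K] [T2Space K]

lemma bump {x : K} {O : Set K} (hO : IsOpen O) (hx : x ∈ O) :
    ∃ u : C₀(K, ℝ), u x = 1 ∧ (∀ z, 0 ≤ u z ∧ u z ≤ 1) ∧
      ∃ C, IsCompact C ∧ ∀ z, z ∉ C ∩ O → u z = 0 := by
  obtain ⟨f, h1, h0, hc, hf⟩ := exists_continuous_one_zero_of_isCompact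
    (isCompact_singleton (x := x)) hO.isClosed_compl (by simpa using hx)
  refine ⟨⟨f, hc.is_zero_at_infty⟩, h1 (mem_singleton x), hf,
    tsupport f, hc, fun z hz => ?_⟩
  by_cases hzO : z ∈ O
  · exact image_eq_zero_of_notMem_tsupport fun h => hz ⟨h, hzO⟩
  · exact h0 hzO

lemma wsum (f : ℕ → C₀(K, ℝ)) (hf : ∀ n z, 0 ≤ f n z ∧ f n z ≤ 1) :
    ∃ w : C₀(K, ℝ), (∀ z, 0 ≤ w z ∧ w z ≤ 1) ∧ (∀ n z, 0 < f n z → 0 < w z) ∧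
      ∀ z, (∀ n, f n z = 0) → w z = 0 := by
  obtain ⟨u, u_pos, u_sum, hu⟩ : ∃ (u : ℕ → ℝ), (∀ i, 0 < u i) ∧ Summable u ∧ ∑' i, u i = 1 :=
    ⟨fun n ↦ 1/2/2^n, fun n ↦ by positivity, summable_geometric_two' 1, tsum_geometric_two' 1⟩
  have hb : ∀ n z, ‖u n * f n z‖ ≤ u n := by
    intro n z
    rw [Real.norm_of_nonneg (mul_nonneg (u_pos n).le (hf n z).1)]
    exact mul_le_of_le_one_right (u_pos n).le (hf n z).2
  have hs : ∀ z, Summable fun n => u n * f n z := fun z =>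
    Summable.of_norm_bounded u_sum fun n => hb n z
  refine ⟨⟨⟨fun z => ∑' n, u n * f n z, ?_⟩, ?_⟩, ?_, ?_, ?_⟩
  · exact continuous_tsum (fun n => continuous_const.mul (map_continuous (f n))) u_sum hb
  · have := tendsto_tsum_of_dominated_convergence (𝓕 := cocompact K)
      (f := fun z n => u n * f n z) (g := fun _ => (0 : ℝ)) u_sum
      (fun n => by
        have := (zero_at_infty (f n)).const_mul (u n)
        simpa using this) (Eventually.of_forall fun z n => hb n z)
    simpa using this
  · intro z
    refine ⟨tsum_nonneg fun n => mul_nonneg (u_pos n).le (hf n z).1, ?_⟩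
    rw [← hu]
    exact (hs z).tsum_le_tsum (fun n => mul_le_of_le_one_right (u_pos n).le (hf n z).2) u_sum
  · intro n z h
    exact (hs z).tsum_pos (fun n => mul_nonneg (u_pos n).le (hf n z).1) n (mul_pos (u_pos n) h)
  · intro z h
    change ∑' n, u n * f n z = 0
    simp [h]

lemma cozero {S V : Set K} (hS : IsLindelof S) (hV : IsOpen V) (hSV : S ⊆ V) :
    ∃ w : C₀(K, ℝ), (∀ z, 0 ≤ w z ∧ w z ≤ 1) ∧ (∀ z ∈ S, 0 < w z) ∧ ∀ z, z ∉ V → w z = 0 := by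
  choose! u hu1 hu2 C hC hu3 using fun (x : K) (hx : x ∈ V) => bump hV hx
  obtain ⟨t, htc, htS, hcov⟩ := hS.elim_nhds_subcover (fun x => {z | 0 < u x z}) (by
    intro x hx
    refine (isOpen_lt continuous_const (map_continuous (u x))).mem_nhds ?_
    simp [hu1 x (hSV hx)])
  rcases t.eq_empty_or_nonempty with rfl | hne
  · refine ⟨0, by simp, ?_, by simp⟩
    intro z hz
    simpa using hcov hz
  · obtain ⟨e, rfl⟩ := htc.exists_eq_range hne
    have heV : ∀ n, e n ∈ V := fun n => hSV (htS _ (mem_range_self n))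
    obtain ⟨w, hw1, hw2, hw3⟩ := wsum (fun n => u (e n)) fun n z => hu2 (e n) (heV n) z
    refine ⟨w, hw1, fun z hz => ?_, fun z hz => hw3 z fun n => hu3 _ (heV n) z fun h => hz h.2⟩
    have := hcov hz
    simp only [mem_iUnion] at this
    obtain ⟨_, ⟨n, rfl⟩, hn⟩ := this
    exact hw2 n z hn

lemma case_sigma_a (w : C₀(K, ℝ)) (hw : ∀ z, 0 ≤ w z ∧ w z ≤ 1)
    (hW : ¬ IsSigmaCompact (closure {z | 0 < w z})) :
    ∃ N : Set C₀(K, ℝ), N ⊆ {f : C₀(K, ℝ) | ‖f‖ = 1} ∧ ¬N.Countable ∧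
      ∀ f ∈ N, ∀ g ∈ N, f ≠ g → 1 < ‖f - g‖ := by
  refine zorn_sep {f | ‖f‖ = 1 ∧ ∃ C, IsCompact C ∧ ∀ z, 0 < w z → z ∉ C → f z < 0}
    (fun f hf => hf.1) ?_
  intro N hN hc
  choose! C hC hfC using fun f (hf : f ∈ N) => (hN hf).2
  obtain ⟨x, hxW, hx⟩ : ∃ x ∈ closure {z | 0 < w z}, ∀ f ∈ N, x ∉ C f := by
    by_contra! hcon
    refine hW ((isSigmaCompact_biUnion hc (S := C)
      fun f hf => (hC f hf).isSigmaCompact).of_isClosed_subset isClosed_closure ?_)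
    intro x hx
    obtain ⟨f, hf, hxf⟩ := hcon x hx
    exact mem_biUnion hf hxf
  obtain ⟨u, hux, hu, D, hD, huD⟩ := bump isOpen_univ (mem_univ x)
  obtain ⟨g, hg⟩ := comb u w 3 1
  have hgx : ∀ z, 1 < 3 * u z - 1 * w z → g z = 1 := by
    intro z hz
    rw [hg, min_eq_left hz.le]; norm_num
  have hx1 : 1 < 3 * u x - 1 * w x := by have := hw x; rw [hux]; linarith
  refine ⟨g, ⟨norm_one (fun z => hg z ▸ clamp_abs _) x (hgx x hx1), D, hD, ?_⟩, ?_⟩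
  · intro z hz hzD
    rw [hg, huD z (fun h => hzD h.1)]
    refine max_lt (by norm_num) (min_lt_of_right_lt (by linarith))
  · intro f hf
    have hopen : IsOpen ({z | 1 < 3 * u z - 1 * w z} ∩ (C f)ᶜ) := by
      refine IsOpen.inter (isOpen_lt continuous_const ?_) (hC f hf).isClosed.isOpen_compl
      have h1 : Continuous u := map_continuous u
      have h2 : Continuous w := map_continuous w
      fun_prop
    obtain ⟨z, ⟨hz1, hz2⟩, hz3⟩ := mem_closure_iff.1 hxW _ hopen ⟨hx1, hx f hf⟩
    apply sep' z
    have := hfC f hf z hz3 hz2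
    rw [hgx z hz1]; linarith

lemma case_sigma_b (hK : ¬ IsSigmaCompact (univ : Set K))
    (h : ∀ w : C₀(K, ℝ), (∀ z, 0 ≤ w z ∧ w z ≤ 1) → IsSigmaCompact (closure {z | 0 < w z})) :
    ∃ N : Set C₀(K, ℝ), N ⊆ {f : C₀(K, ℝ) | ‖f‖ = 1} ∧ ¬N.Countable ∧
      ∀ f ∈ N, ∀ g ∈ N, f ≠ g → 1 < ‖f - g‖ := by
  refine zorn_sep {f | ‖f‖ = 1 ∧ ∃ x, f x = 1} (fun f hf => hf.1) ?_
  intro N hN hc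
  have hne : Nonempty K := by
    by_contra hcon
    rw [not_nonempty_iff] at hcon
    exact hK (by rw [univ_eq_empty_iff.2 hcon]; exact isSigmaCompact_empty)
  choose! p hp using fun f (hf : f ∈ N) => (hN hf).2
  obtain ⟨w, hw1, hw2, -⟩ := cozero (hc.image p).isLindelof isOpen_univ (subset_univ _)
  obtain ⟨x, hx⟩ : ∃ x, x ∉ closure {z | 0 < w z} := by
    by_contra! hcon
    exact hK (eq_univ_of_forall hcon ▸ h w hw1)
  obtain ⟨u, hux, hu, D, hD, huD⟩ := bump isClosed_closure.isOpen_compl hx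
  have hwx : w x = 0 := le_antisymm (not_lt.1 fun h => hx (subset_closure h)) (hw1 x).1
  obtain ⟨g, hg⟩ := comb u w 1 1
  have hgx : g x = 1 := by rw [hg, hux, hwx]; norm_num
  refine ⟨g, ⟨norm_one (fun z => hg z ▸ clamp_abs _) x hgx, x, hgx⟩, fun f hf => ?_⟩
  rw [norm_sub_rev]
  apply sep' (p f)
  have hpos := hw2 (p f) (mem_image_of_mem p hf)
  have : g (p f) < 0 := by
    rw [hg, huD (p f) (fun h => h.2 (subset_closure hpos))]
    exact max_lt (by norm_num) (min_lt_of_right_lt (by linarith))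
  rw [hp f hf]; linarith

lemma case_notHL (hK : IsLindelof (univ : Set K)) (S : Set K) (hS : ¬ IsLindelof S) :
    ∃ N : Set C₀(K, ℝ), N ⊆ {f : C₀(K, ℝ) | ‖f‖ = 1} ∧ ¬N.Countable ∧
      ∀ f ∈ N, ∀ g ∈ N, f ≠ g → 1 < ‖f - g‖ := by
  obtain ⟨e, he1, he2, -⟩ := cozero hK isOpen_univ subset_rfl
  rw [isLindelof_iff_countable_subcover] at hS
  push Not at hS
  obtain ⟨ι, U, hU, hSU, hno⟩ := hS
  refine zorn_sep {f | ‖f‖ = 1 ∧ ∃ i, ∀ z, z ∉ U i → f z < 0} (fun f hf => hf.1) ?_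
  intro N hN hc
  have hne : Nonempty ι := by
    obtain ⟨x, hxS, -⟩ := not_subset.1 (hno ∅ countable_empty)
    obtain ⟨j, -⟩ := mem_iUnion.1 (hSU hxS)
    exact ⟨j⟩
  choose! i hi using fun f (hf : f ∈ N) => (hN hf).2
  obtain ⟨x, hxS, hx⟩ : ∃ x ∈ S, ∀ f ∈ N, x ∉ U (i f) := by
    have := hno (i '' N) (hc.image i)
    rw [not_subset] at this
    obtain ⟨x, hxS, hx⟩ := this
    refine ⟨x, hxS, fun f hf hxf => hx ?_⟩
    exact mem_biUnion (mem_image_of_mem i hf) hxf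
  obtain ⟨j, hj⟩ := mem_iUnion.1 (hSU hxS)
  obtain ⟨u, hux, hu, D, hD, huD⟩ := bump (hU j) hj
  obtain ⟨g, hg⟩ := comb u e 3 1
  have hgx : g x = 1 := by
    rw [hg, hux, min_eq_left (by linarith [(he1 x).2])]; norm_num
  refine ⟨g, ⟨norm_one (fun z => hg z ▸ clamp_abs _) x hgx, j, ?_⟩, fun f hf => ?_⟩
  · intro z hz
    rw [hg, huD z (fun h => hz h.2)]
    exact max_lt (by norm_num) (min_lt_of_right_lt (by linarith [he2 z (mem_univ z)]))
  · apply sep' x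
    have := hi f hf x (hx f hf)
    rw [hgx]; linarith

lemma metrizable_of (e : C₀(K, ℝ)) (he : ∀ z, 0 < e z) (N : Set C₀(K, ℝ)) (hN : N.Countable)
    (hsep : ∀ x y : K, e x = e y → (∀ f ∈ N, f x = f y) → x = y) :
    TopologicalSpace.MetrizableSpace K := by
  have : Countable N := hN.to_subtype
  let Φ : K → ℝ × (N → ℝ) := fun x => (e x, fun f => f.1 x)
  have he_cont : Continuous e := map_continuous e
  have hΦ : Continuous Φ :=
    he_cont.prodMk (continuous_pi fun f => map_continuous f.1)
  have hinj : Function.Injective Φ := by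
    intro x y hxy
    refine hsep x y (congrArg Prod.fst hxy) fun f hf => ?_
    exact congrFun (congrArg Prod.snd hxy) ⟨f, hf⟩
  have hemb : IsEmbedding Φ := by
    refine ⟨isInducing_iff_nhds.2 fun x => le_antisymm (hΦ.tendsto x).le_comap ?_, hinj⟩
    intro O hO
    obtain ⟨O', hO'O, hO'o, hxO'⟩ := mem_nhds_iff.1 hO
    have hpos : 0 < e x / 2 := by have := he x; positivity
    have hcomp : IsCompact {z | e x / 2 ≤ e z} := by
      have h0 : Tendsto e (cocompact K) (𝓝 0) := zero_at_infty e
      have h1 : ∀ᶠ z in cocompact K, e z < e x / 2 := h0.eventually (gt_mem_nhds hpos)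
      obtain ⟨t, ht, hts⟩ := mem_cocompact.1 h1
      refine ht.of_isClosed_subset (isClosed_le continuous_const he_cont) fun z hz => ?_
      by_contra hzt
      have h2 : e z < e x / 2 := hts hzt
      have h3 : e x / 2 ≤ e z := hz
      linarith
    have hcl : IsClosed (Φ '' ({z | e x / 2 ≤ e z} \ O')) :=
      ((hcomp.diff hO'o).image hΦ).isClosed
    refine mem_comap.2 ⟨(Φ '' ({z | e x / 2 ≤ e z} \ O'))ᶜ ∩ {q | e x / 2 < q.1},
      (hcl.isOpen_compl.inter (isOpen_lt continuous_const continuous_fst)).mem_nhds ⟨?_, ?_⟩, ?_⟩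
    · rintro ⟨z, hz, hzx⟩
      rw [hinj hzx] at hz
      exact hz.2 hxO'
    · change e x / 2 < e x
      linarith
    · rintro z ⟨hz1, hz2⟩
      apply hO'O
      by_contra hzO
      have h3 : e x / 2 < e z := hz2
      exact hz1 ⟨z, ⟨h3.le, hzO⟩, rfl⟩
  exact hemb.metrizableSpace

lemma case_HL (hK : ¬ TopologicalSpace.MetrizableSpace K) (hL : ∀ S : Set K, IsLindelof S) :
    ∃ N : Set C₀(K, ℝ), N ⊆ {f : C₀(K, ℝ) | ‖f‖ = 1} ∧ ¬N.Countable ∧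
      ∀ f ∈ N, ∀ g ∈ N, f ≠ g → 1 < ‖f - g‖ := by
  obtain ⟨e, he1, he2, -⟩ := cozero (hL univ) isOpen_univ subset_rfl
  refine zorn_sep {f | ‖f‖ = 1 ∧ ∀ z, f z = 0 → z ∈ closure {z | f z < 0}} (fun f hf => hf.1) ?_
  intro N hN hc
  obtain ⟨x, y, hxy, hne⟩ : ∃ x y : K, (∀ f ∈ N, f x = f y) ∧ x ≠ y := by
    by_contra! hcon
    exact hK (metrizable_of e (fun z => he2 z (mem_univ z)) N hc fun x y _ h => hcon x y h)
  obtain ⟨A, V, hA, hV, hxA, hyV, hAV⟩ := t2_separation hne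
  have hxV : x ∉ closure V := fun h => by
    obtain ⟨z, hz⟩ := mem_closure_iff.1 h A hA hxA
    exact hAV.le_bot hz
  obtain ⟨u, hu1, hu2, hu3⟩ := cozero (hL (closure V)ᶜ) isClosed_closure.isOpen_compl subset_rfl
  obtain ⟨v, hv1, hv2, hv3⟩ := cozero (hL V) hV subset_rfl
  have hux : 0 < u x := hu2 x hxV
  have hvy : 0 < v y := hv2 y hyV
  obtain ⟨g, hg⟩ := comb u v (2 / u x) (1 / v y)
  have ha : 0 < 2 / u x := by positivity
  have hb : 0 < 1 / v y := by positivity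
  have hvU : ∀ z, z ∉ closure V → v z = 0 := fun z hz => hv3 z fun h => hz (subset_closure h)
  have huV : ∀ z, z ∈ closure V → u z = 0 := fun z hz => hu3 z fun h => h hz
  have hg1 : ∀ z, 1 < 2 / u x * u z - 1 / v y * v z → g z = 1 := by
    intro z hz
    rw [hg, min_eq_left hz.le]; norm_num
  have hx1 : 1 < 2 / u x * u x - 1 / v y * v x := by
    rw [hvU x hxV, div_mul_cancel₀ _ hux.ne']; norm_num
  have hgy : g y = -1 := by
    rw [hg, huV y (subset_closure hyV), div_mul_cancel₀ _ hvy.ne']; norm_num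
  have hgneg : ∀ z ∈ V, g z < 0 := by
    intro z hz
    rw [hg, huV z (subset_closure hz)]
    have := mul_pos hb (hv2 z hz)
    exact max_lt (by norm_num) (min_lt_of_right_lt (by linarith))
  refine ⟨g, ⟨norm_one (fun z => hg z ▸ clamp_abs _) x (hg1 x hx1), ?_⟩, ?_⟩
  · intro z hz
    by_cases hzV : z ∈ closure V
    · exact closure_mono (fun z hz => hgneg z hz) hzV
    · exfalso
      have : 0 < g z := by
        rw [hg, hvU z hzV]
        have := mul_pos ha (hu2 z hzV)
        exact lt_max_of_lt_right (lt_min one_pos (by linarith))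
      linarith
  · intro f hf
    rcases lt_trichotomy (f x) 0 with h | h | h
    · apply sep' x
      rw [hg1 x hx1]; linarith
    · have hcl := (hN hf).2 x h
      have hopen : IsOpen {z | 1 < 2 / u x * u z - 1 / v y * v z} := by
        have h1 : Continuous u := map_continuous u
        have h2 : Continuous v := map_continuous v
        exact isOpen_lt continuous_const (by fun_prop)
      obtain ⟨z, hz1, hz2⟩ := mem_closure_iff.1 hcl _ hopen hx1
      apply sep' z
      have hz2' : f z < 0 := hz2
      rw [hg1 z hz1]; linarith
    · rw [norm_sub_rev]
      apply sep' y
      rw [hgy, ← hxy f hf]; linarith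

end Stmt17

/- STATEMENT 17: If `K` is a locally compact, Hausdorff, nonmetrizable topological
space, then the unit sphere of `C₀(K)` admits an uncountable `(1+)`-separated set. -/
theorem stmt17 (K : Type*) [TopologicalSpace K] [LocallyCompactSpace K] [T2Space K]
    (hK : ¬TopologicalSpace.MetrizableSpace K) :
    ∃ N : Set C₀(K, ℝ), N ⊆ {f : C₀(K, ℝ) | ‖f‖ = 1} ∧ ¬N.Countable ∧
      ∀ f ∈ N, ∀ g ∈ N, f ≠ g → 1 < ‖f - g‖ := by
  by_cases hσ : IsSigmaCompact (univ : Set K)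
  · have : SigmaCompactSpace K := isSigmaCompact_univ_iff.1 hσ
    by_cases hL : ∀ S : Set K, IsLindelof S
    · exact Stmt17.case_HL hK hL
    · push Not at hL
      obtain ⟨S, hS⟩ := hL
      exact Stmt17.case_notHL isLindelof_univ S hS
  · by_cases h : ∀ w : C₀(K, ℝ), (∀ z, 0 ≤ w z ∧ w z ≤ 1) → IsSigmaCompact (closure {z | 0 < w z})
    · exact Stmt17.case_sigma_b hσ h
    · push Not at h
      obtain ⟨w, hw, hW⟩ := h
      exact Stmt17.case_sigma_a w hw hW
end
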